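/- Under the hypotheses of the Krasnosel'skii–Mann iteration on R^d (T nonexpansive with a fixed point, α ∈ (0,1)), the iterates z(k) converge to some fixed point of T. -/

import Mathlib

open Filter

/-- Convergence of the Krasnosel'skii–Mann iteration in `ℝ^d`: the iterates
converge to some fixed point of `T`. -/
theorem stmt13 (d : ℕ)
    (T : EuclideanSpace ℝ (Fin d) → EuclideanSpace ℝ (Fin d))
    (hTc : Continuous T)
    (hT : ∀ x y, ‖T x - T y‖ ≤ ‖x - y‖)
    (hfix : ∃ zstar, T zstar = zstar)
    (α : ℝ) (hα0 : 0 < α) (hα1 : α < 1)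
    (z : ℕ → EuclideanSpace ℝ (Fin d))
    (hiter : ∀ k, z (k + 1) = (1 - α) • z k + α • T (z k)) :
    ∃ zhat, T zhat = zhat ∧ Tendsto z atTop (nhds zhat) := by
  have key : ∀ p, T p = p → ∀ k,
      α * (1 - α) * ‖z k - T (z k)‖ ^ 2 ≤ ‖z k - p‖ ^ 2 - ‖z (k + 1) - p‖ ^ 2 := by
    intro p hp k
    have h1 : z (k + 1) - p = (1 - α) • (z k - p) + α • (T (z k) - p) := by
      rw [hiter k]; module
    have h2 : z k - T (z k) = (z k - p) - (T (z k) - p) := by abel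
    have h3 : ‖T (z k) - p‖ ≤ ‖z k - p‖ := by
      have := hT (z k) p
      rwa [hp] at this
    have h4 : ‖T (z k) - p‖ ^ 2 ≤ ‖z k - p‖ ^ 2 :=
      pow_le_pow_left₀ (norm_nonneg _) h3 2
    rw [h1, h2, norm_add_sq_real, norm_sub_sq_real, norm_smul, norm_smul,
      real_inner_smul_left, real_inner_smul_right, mul_pow, mul_pow,
      Real.norm_eq_abs, Real.norm_eq_abs, sq_abs, sq_abs]
    nlinarith [mul_le_mul_of_nonneg_left h4 hα0.le]
  have hc : 0 < α * (1 - α) := mul_pos hα0 (by linarith)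
  have anti : ∀ p, T p = p → Antitone (fun k => ‖z k - p‖ ^ 2) := by
    intro p hp
    refine antitone_nat_of_succ_le fun k => ?_
    have h1 := key p hp k
    have h2 : 0 ≤ α * (1 - α) * ‖z k - T (z k)‖ ^ 2 := by positivity
    linarith
  have conv : ∀ p, T p = p → ∃ l, Tendsto (fun k => ‖z k - p‖ ^ 2) atTop (nhds l) := by
    intro p hp
    refine ⟨_, tendsto_atTop_ciInf (anti p hp) ⟨0, ?_⟩⟩
    rintro _ ⟨k, rfl⟩
    positivity
  obtain ⟨p, hp⟩ := hfix
  have hres : Tendsto (fun k => ‖z k - T (z k)‖ ^ 2) atTop (nhds 0) := by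
    obtain ⟨l, hl⟩ := conv p hp
    have h1 := (hl.sub (hl.comp (tendsto_add_atTop_nat 1))).div_const (α * (1 - α))
    rw [sub_self, zero_div] at h1
    refine squeeze_zero (fun k => by positivity) (fun k => ?_) h1
    rw [le_div_iff₀ hc, mul_comm]
    exact key p hp k
  have hb : ∀ k, z k ∈ Metric.closedBall p ‖z 0 - p‖ := by
    intro k
    rw [mem_closedBall_iff_norm]
    exact (sq_le_sq₀ (norm_nonneg _) (norm_nonneg _)).1 (anti p hp (Nat.zero_le k))
  obtain ⟨q, -, φ, hφ, hq⟩ := tendsto_subseq_of_bounded Metric.isBounded_closedBall hb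
  have hTq : T q = q := by
    have h1 : Tendsto (fun k => ‖z (φ k) - T (z (φ k))‖ ^ 2) atTop (nhds (‖q - T q‖ ^ 2)) :=
      ((hq.sub ((hTc.tendsto q).comp hq)).norm).pow 2
    have h2 := tendsto_nhds_unique h1 (hres.comp hφ.tendsto_atTop)
    have h3 : ‖q - T q‖ = 0 := by simpa using h2
    exact (sub_eq_zero.1 (norm_eq_zero.1 h3)).symm
  refine ⟨q, hTq, ?_⟩
  obtain ⟨l, hl⟩ := conv q hTq
  have h1 : Tendsto (fun k => ‖z (φ k) - q‖ ^ 2) atTop (nhds (‖q - q‖ ^ 2)) :=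
    ((hq.sub_const q).norm).pow 2
  have h2 : l = 0 := by
    have := tendsto_nhds_unique (hl.comp hφ.tendsto_atTop) h1
    simpa using this
  rw [h2] at hl
  rw [tendsto_iff_norm_sub_tendsto_zero]
  have h3 := hl.sqrt
  simpa [Real.sqrt_sq (norm_nonneg _)] using h3
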